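/- arXiv:2208.11976 — 2 statements merged into one kernel-verified Lean document; each statement's English description precedes it below -/
import Mathlib

section
/- For all k ≥ 1 and x ∈ [1/2, 1), u_{k+4}(x) ≥ u_k(x), where u_k(x) = λ^(k)(x)/(k+1)! and λ(x) = ln x − ln(1−x). -/
open Real

/-- λ(x) = ln x − ln(1−x). -/
noncomputable def lam (x : ℝ) : ℝ := Real.log x - Real.log (1 - x)

/-- u_k(x) = λ⁽ᵏ⁾(x)/(k+1)!, with u_0 = λ. -/
noncomputable def u (k : ℕ) (x : ℝ) : ℝ := iteratedDeriv k lam x / (Nat.factorial (k + 1) : ℝ)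

theorem iteratedDeriv_succ_lam (n : ℕ) {x : ℝ} (hx : x ∈ Set.Ioo (0 : ℝ) 1) :
    iteratedDeriv (n + 1) lam x =
      (n.factorial : ℝ) * ((1 - x)⁻¹ ^ (n + 1) + (-1) ^ n * x⁻¹ ^ (n + 1)) := by
  induction n generalizing x with
  | zero =>
    have h0 : x ≠ 0 := hx.1.ne'
    have h1 : 1 - x ≠ 0 := (sub_pos.2 hx.2).ne'
    have h := (Real.hasDerivAt_log h0).sub (((hasDerivAt_id x).const_sub 1).log h1)
    rw [zero_add, iteratedDeriv_one]
    refine (HasDerivAt.deriv (f := lam) h).trans ?_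
    simp only [id, Nat.factorial_zero, Nat.cast_one, pow_zero, pow_one]
    ring
  | succ n ih =>
    have h0 : x ≠ 0 := hx.1.ne'
    have h1 : 1 - x ≠ 0 := (sub_pos.2 hx.2).ne'
    have hev : iteratedDeriv (n + 1) lam =ᶠ[nhds x] fun y =>
        (n.factorial : ℝ) * ((1 - y)⁻¹ ^ (n + 1) + (-1) ^ n * y⁻¹ ^ (n + 1)) := by
      filter_upwards [isOpen_Ioo.mem_nhds hx] with y hy using ih hy
    have h := ((((hasDerivAt_id x).const_sub 1).fun_inv h1).fun_pow (n + 1)).fun_add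
      (((hasDerivAt_inv h0).fun_pow (n + 1)).const_mul ((-1 : ℝ) ^ n))
    rw [iteratedDeriv_succ, hev.deriv_eq]
    refine (h.const_mul (n.factorial : ℝ)).deriv.trans ?_
    simp only [id, Nat.factorial_succ, Nat.add_sub_cancel, div_eq_mul_inv, ← inv_pow]
    push_cast
    ring

theorem u_succ_eq (n : ℕ) {x : ℝ} (hx : x ∈ Set.Ioo (0 : ℝ) 1) :
    u (n + 1) x =
      ((1 - x)⁻¹ ^ (n + 1) + (-1) ^ n * x⁻¹ ^ (n + 1)) / (((n : ℝ) + 1) * (n + 2)) := by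
  have hf : (n.factorial : ℝ) ≠ 0 := by positivity
  rw [u, iteratedDeriv_succ_lam n hx, Nat.factorial_succ, Nat.factorial_succ]
  push_cast
  field_simp
  ring

theorem sixteen_mul_pow_add_pow_le {a b : ℝ} (ha : 0 ≤ a) (hab : a ≤ b) (h : 4 ≤ a + b) (m : ℕ) :
    16 * (b ^ m + a ^ m) ≤ b ^ (m + 4) + a ^ (m + 4) := by
  have hm : a ^ m ≤ b ^ m := pow_le_pow_left₀ ha hab m
  have h4 : a ^ 4 ≤ b ^ 4 := pow_le_pow_left₀ ha hab 4
  have hsq : 8 ≤ a ^ 2 + b ^ 2 := by nlinarith [sq_nonneg (a - b)]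
  have hfour : 32 ≤ a ^ 4 + b ^ 4 := by nlinarith [sq_nonneg (a ^ 2 - b ^ 2)]
  have hpos : 0 ≤ a ^ m := pow_nonneg ha m
  rw [pow_add, pow_add]
  nlinarith [mul_nonneg (sub_nonneg.2 hm) (sub_nonneg.2 h4),
    mul_nonneg (add_nonneg (hpos.trans hm) hpos) (sub_nonneg.2 hfour)]

theorem sixteen_mul_pow_sub_pow_le {a b : ℝ} (ha : 0 ≤ a) (ha2 : a ≤ 2) (hb : 2 ≤ b) (m : ℕ) :
    16 * (b ^ m - a ^ m) ≤ b ^ (m + 4) - a ^ (m + 4) := by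
  have ha4 : a ^ 4 ≤ 2 ^ 4 := pow_le_pow_left₀ ha ha2 4
  have hb4 : 2 ^ 4 ≤ b ^ 4 := pow_le_pow_left₀ (by norm_num) hb 4
  rw [pow_add, pow_add]
  nlinarith [mul_nonneg (pow_nonneg ha m) (sub_nonneg.2 ha4),
    mul_nonneg (pow_nonneg (by linarith : 0 ≤ b) m) (sub_nonneg.2 hb4)]

theorem stmt9 (k : ℕ) (hk : 1 ≤ k) (x : ℝ) (hx : x ∈ Set.Ico (1 / 2 : ℝ) 1) :
    u k x ≤ u (k + 4) x := by
  obtain ⟨n, rfl⟩ := Nat.exists_eq_add_of_le' hk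
  obtain ⟨hx2, hx1⟩ := hx
  have hx0 : 0 < x := by linarith
  have hy0 : 0 < 1 - x := by linarith
  rw [show n + 1 + 4 = n + 4 + 1 by ring, u_succ_eq n ⟨hx0, hx1⟩, u_succ_eq (n + 4) ⟨hx0, hx1⟩]
  have ha : 0 ≤ x⁻¹ := by positivity
  have ha2 : x⁻¹ ≤ 2 := by
    rw [inv_le_comm₀ hx0 two_pos]; linarith
  have hb : 2 ≤ (1 - x)⁻¹ := by
    rw [le_inv_comm₀ two_pos hy0]; linarith
  have hsum : 4 ≤ x⁻¹ + (1 - x)⁻¹ := by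
    have h : x⁻¹ + (1 - x)⁻¹ = 1 / (x * (1 - x)) := by field_simp; ring
    rw [h, le_div_iff₀ (by positivity)]
    nlinarith [sq_nonneg (2 * x - 1)]
  generalize x⁻¹ = a at *
  generalize (1 - x)⁻¹ = b at *
  have hm : a ^ (n + 1) ≤ b ^ (n + 1) := pow_le_pow_left₀ ha (ha2.trans hb) _
  have hpos : 0 ≤ a ^ (n + 1) := pow_nonneg ha _
  obtain ⟨hnonneg, hle⟩ : 0 ≤ b ^ (n + 1) + (-1) ^ n * a ^ (n + 1) ∧
      16 * (b ^ (n + 1) + (-1) ^ n * a ^ (n + 1)) ≤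
        b ^ (n + 4 + 1) + (-1) ^ (n + 4) * a ^ (n + 4 + 1) := by
    rw [show n + 4 + 1 = n + 1 + 4 by ring, pow_add (-1 : ℝ) n 4]
    rcases neg_one_pow_eq_or ℝ n with h | h <;> rw [h]
    · have := sixteen_mul_pow_add_pow_le ha (ha2.trans hb) hsum (n + 1)
      constructor <;> linarith
    · have := sixteen_mul_pow_sub_pow_le ha ha2 hb (n + 1)
      constructor <;> linarith
  have hn : (0 : ℝ) ≤ n := n.cast_nonneg
  rw [div_le_div_iff₀ (by positivity) (by positivity)]
  push_cast
  have hcoef : ((n : ℝ) + 4 + 1) * (n + 4 + 2) ≤ 16 * ((n + 1) * (n + 2)) := by nlinarith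
  calc _ ≤ (b ^ (n + 1) + (-1) ^ n * a ^ (n + 1)) * (16 * (((n : ℝ) + 1) * (n + 2))) :=
        mul_le_mul_of_nonneg_left hcoef hnonneg
    _ = 16 * (b ^ (n + 1) + (-1) ^ n * a ^ (n + 1)) * (((n : ℝ) + 1) * (n + 2)) := by ring
    _ ≤ _ := mul_le_mul_of_nonneg_right hle (by positivity)
end

section
/- For k ≥ 1, l ∈ {1,...,k}, q ≥ 1, z ∈ [1/2, 1), t ∈ ℝ, and p ∈ (0,1], the Lq norm on [1/2, z] of the k-th x-derivative of g(t,x) = exp(i·t·[p·x·log₂(p·x) + p·(1−x)·log₂(p·(1−x)) − p·log₂(p/2)]) satisfies: (∫_{1/2}^{z} |∂ₓᵏ g(t,x)|^q dx)^{1/q} ≤ ∑_{l=1}^{k} |t·p/ln 2|ˡ · L(k,l) · (2/((r(k−l)+1)·r(k−l)))ˡ · (1−z)^{−l·r(k−l)+1/q} / (q·l·r(k−l) − 1)^{1/q}, where L(k,l) = C(k−1,l−1)·k!/l! is the Lah number and r(m) = max(5, 2⌈(m−1)/2⌉+1). -/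
open Real Finset

/-- g(t,x) = exp(i t [px log₂(px) + p(1−x) log₂(p(1−x)) − p log₂(p/2)]). -/
noncomputable def g (p t x : ℝ) : ℂ :=
  Complex.exp (Complex.I * (t : ℂ) *
    ((p * x * logb 2 (p * x) + p * (1 - x) * logb 2 (p * (1 - x))
      - p * logb 2 (p / 2) : ℝ) : ℂ))

/-- r(k) = max(5, 2⌈(k−1)/2⌉ + 1); for natural k, ⌈(k−1)/2⌉ = ⌊k/2⌋. -/
def r (k : ℕ) : ℕ := max 5 (2 * (k / 2) + 1)

/-- Lah number L(k,l) = C(k−1, l−1)·k!/l!. -/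
noncomputable def lah (k l : ℕ) : ℝ :=
  (Nat.choose (k - 1) (l - 1) : ℝ) * (Nat.factorial k : ℝ) / (Nat.factorial l : ℝ)

theorem sum_mul_choose_pred (k l : ℕ) (hl : 1 ≤ l) :
    ∑ m ∈ Finset.Icc l k, (k + 1 - m) * (m - 1).choose (l - 1) = (k + 1).choose (l + 1) := by
  have hockey (k : ℕ) : ∑ m ∈ Finset.Icc l k, (m - 1).choose (l - 1) = k.choose l := by
    obtain ⟨l, rfl⟩ := Nat.exists_eq_add_of_le' hl
    induction k with
    | zero => simp
    | succ k ih =>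
      rcases le_or_gt l k with h | h
      · rw [Finset.sum_Icc_succ_top (by omega), ih, Nat.choose_succ_succ k l]
        simp [add_comm]
      · rw [Finset.Icc_eq_empty (by omega), Nat.choose_eq_zero_of_lt (by omega)]; simp
  induction k with
  | zero =>
    rw [Finset.Icc_eq_empty (by omega), Nat.choose_eq_zero_of_lt (by omega)]; simp
  | succ k ih =>
    rw [Nat.choose_succ_succ (k + 1) l, ← ih, ← hockey (k + 1)]
    rcases le_or_gt l (k + 1) with h | h
    · rw [Finset.sum_Icc_succ_top h, Finset.sum_Icc_succ_top h,
        add_right_comm (∑ m ∈ Finset.Icc l k, (m - 1).choose (l - 1)),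
        ← Finset.sum_add_distrib]
      congr 1
      · refine Finset.sum_congr rfl fun m hm => ?_
        have := (Finset.mem_Icc.mp hm).2
        rw [show k + 1 + 1 - m = (k + 1 - m) + 1 by omega]; ring
      · rw [show k + 1 + 1 - (k + 1) = 1 by omega, one_mul]
    · rw [Finset.Icc_eq_empty (by omega), Finset.Icc_eq_empty (by omega)]; simp

theorem sum_choose_mul_factorial_mul_lah (k l : ℕ) (hl : 1 ≤ l) :
    ∑ m ∈ Finset.Icc l k, (k.choose m : ℝ) * (k + 1 - m).factorial * lah m l
      = lah (k + 1) (l + 1) := by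
  have key : ((k + 1 : ℕ) : ℝ) * k.choose l = (k + 1).choose (l + 1) * ((l + 1 : ℕ) : ℝ) := by
    exact_mod_cast Nat.add_one_mul_choose_eq k l
  have h : ∀ m ∈ Finset.Icc l k, (k.choose m : ℝ) * (k + 1 - m).factorial * lah m l
      = (k.factorial / l.factorial : ℝ) * (((k + 1 - m) * (m - 1).choose (l - 1) : ℕ) : ℝ) := by
    intro m hm
    have hm' := (Finset.mem_Icc.mp hm).2
    rw [lah, Nat.cast_choose ℝ hm', show k + 1 - m = (k - m) + 1 by omega, Nat.factorial_succ]
    push_cast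
    field_simp
  rw [Finset.sum_congr rfl h, ← Finset.mul_sum, ← Nat.cast_sum, sum_mul_choose_pred k l hl, lah,
    Nat.add_sub_cancel, Nat.add_sub_cancel, Nat.factorial_succ, Nat.factorial_succ]
  push_cast at key ⊢
  field_simp
  linarith

theorem lah_nonneg (k l : ℕ) : 0 ≤ lah k l := by unfold lah; positivity

/-- A sequence obeying the Leibniz-type recurrence of the derivatives of an exponential is bounded
by the corresponding sum over Lah numbers. -/
theorem le_sum_lah_of_recurrence {G u U : ℕ → ℝ} {c : ℝ} (hc : 0 ≤ c) (hG0 : G 0 ≤ 1)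
    (hU : Monotone U) (hU0 : ∀ n, 0 ≤ U n) (hG : ∀ n, 0 ≤ G n) (huU : ∀ n, u n ≤ U n)
    (hrec : ∀ k, G (k + 1) ≤ ∑ m ∈ Finset.range (k + 1),
      (k.choose m : ℝ) * (c * ((k + 1 - m).factorial * u (k - m))) * G m)
    {k : ℕ} (hk : 1 ≤ k) :
    G k ≤ ∑ l ∈ Finset.Icc 1 k, c ^ l * lah k l * U (k - l) ^ l := by
  induction k using Nat.strong_induction_on with
  | _ k ih =>
    obtain ⟨k, rfl⟩ := Nat.exists_eq_add_of_le' hk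
    refine (hrec k).trans ?_
    rw [Finset.sum_range_succ']
    have h0 : ((k.choose 0 : ℕ) : ℝ) * (c * ((k + 1 - 0).factorial * u (k - 0))) * G 0
        ≤ c ^ 1 * lah (k + 1) 1 * U (k + 1 - 1) ^ 1 := by
      have h1 : u k * G 0 ≤ U k * 1 := mul_le_mul (huU k) hG0 (hG 0) (hU0 k)
      have h2 : 0 ≤ c * (k + 1).factorial := by positivity
      have := mul_le_mul_of_nonneg_left h1 h2
      simp [lah]
      linarith
    have hm : ∀ m ∈ Finset.range k,
        (k.choose (m + 1) : ℝ) * (c * ((k + 1 - (m + 1)).factorial * u (k - (m + 1)))) * G (m + 1)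
          ≤ ∑ l ∈ Finset.Icc 1 (m + 1), c ^ (l + 1) * U (k - l) ^ (l + 1) *
            ((k.choose (m + 1) : ℝ) * (k + 1 - (m + 1)).factorial * lah (m + 1) l) := by
      intro m hm
      have hmk := Finset.mem_range.mp hm
      calc _ ≤ (k.choose (m + 1) : ℝ) * (c * ((k + 1 - (m + 1)).factorial * U (k - (m + 1)))) *
            ∑ l ∈ Finset.Icc 1 (m + 1), c ^ l * lah (m + 1) l * U (m + 1 - l) ^ l := by
            have := hU0 (k - (m + 1))
            gcongr
            · exact hG _
            · exact huU _
            · exact ih (m + 1) (by omega) (by omega)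
        _ ≤ _ := by
            rw [Finset.mul_sum]
            refine Finset.sum_le_sum fun l hl => ?_
            have hl' := Finset.mem_Icc.mp hl
            have h1 : U (k - (m + 1)) * U (m + 1 - l) ^ l ≤ U (k - l) ^ (l + 1) := by
              rw [pow_succ']
              have := hU0 (m + 1 - l)
              have := hU0 (k - l)
              gcongr
              · exact hU (by omega)
              · exact hU (by omega)
            have h2 : 0 ≤ c ^ (l + 1) *
                ((k.choose (m + 1) : ℝ) * (k + 1 - (m + 1)).factorial * lah (m + 1) l) := by
              have := lah_nonneg (m + 1) l
              positivity
            calc _ = _ := ?_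
              _ ≤ _ := mul_le_mul_of_nonneg_left h1 h2
              _ = _ := by ring
            ring
    have hsplit : ∑ l ∈ Finset.Icc 1 (k + 1), c ^ l * lah (k + 1) l * U (k + 1 - l) ^ l
        = (∑ l ∈ Finset.Icc 1 k, c ^ (l + 1) * lah (k + 1) (l + 1) * U (k - l) ^ (l + 1))
          + c ^ 1 * lah (k + 1) 1 * U (k + 1 - 1) ^ 1 := by
      rw [← Finset.add_sum_Ioc_eq_sum_Icc (by omega), add_comm]
      congr 1
      rw [← Finset.Icc_add_one_left_eq_Ioc, ← Finset.map_add_right_Icc, Finset.sum_map]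
      simp
    rw [hsplit]
    refine add_le_add ((Finset.sum_le_sum hm).trans_eq ?_) h0
    rw [Finset.range_eq_Ico]
    refine (Finset.sum_Ico_add' (fun m => ∑ l ∈ Finset.Icc 1 m, c ^ (l + 1) * U (k - l) ^ (l + 1) *
      ((k.choose m : ℝ) * (k + 1 - m).factorial * lah m l)) 0 k 1).trans ?_
    rw [Finset.sum_comm' (t' := Finset.Icc 1 k) (s' := fun l => Finset.Icc l k)]
    · refine Finset.sum_congr rfl fun l hl => ?_
      rw [← Finset.mul_sum, sum_choose_mul_factorial_mul_lah k l (Finset.mem_Icc.mp hl).1]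
      ring
    · intro m l
      simp only [Finset.mem_Ico, Finset.mem_Icc]
      omega

/-- Closed form of the `m`-th derivative of `x ↦ log x - log (1 - x)` on `(0, 1)`. -/
noncomputable def logitDeriv : ℕ → ℝ → ℝ
  | 0, x => Real.log x - Real.log (1 - x)
  | m + 1, x => m.factorial * ((-1) ^ m * (x ^ (m + 1))⁻¹ + ((1 - x) ^ (m + 1))⁻¹)

theorem hasDerivAt_logitDeriv (m : ℕ) {x : ℝ} (hx : x ∈ Set.Ioo (0 : ℝ) 1) :
    HasDerivAt (logitDeriv m) (logitDeriv (m + 1) x) x := by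
  have h0 : x ≠ 0 := hx.1.ne'
  have h1 : 1 - x ≠ 0 := (sub_pos.mpr hx.2).ne'
  have hsub : HasDerivAt (fun y : ℝ => 1 - y) (-1) x := by
    simpa using (hasDerivAt_id x).const_sub 1
  cases m with
  | zero =>
    have h := (Real.hasDerivAt_log h0).sub (hsub.log h1)
    refine h.congr_deriv ?_
    simp [logitDeriv]
    field_simp
    ring
  | succ m =>
    have ha := ((hasDerivAt_pow (m + 1) x).inv (pow_ne_zero _ h0)).const_mul ((-1 : ℝ) ^ m)
    have hb := (hsub.pow (m + 1)).inv (pow_ne_zero _ h1)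
    have h := (ha.add hb).const_mul (m.factorial : ℝ)
    refine h.congr_deriv ?_
    simp only [logitDeriv, Nat.factorial_succ, Pi.pow_apply]
    push_cast
    field_simp
    ring

theorem iteratedDeriv_const_mul_logit (c : ℂ) (m : ℕ) {x : ℝ} (hx : x ∈ Set.Ioo (0 : ℝ) 1) :
    iteratedDeriv m (fun y : ℝ => c * (logitDeriv 0 y : ℂ)) x = c * (logitDeriv m x : ℂ) := by
  induction m generalizing x with
  | zero => simp
  | succ m ih =>
    rw [iteratedDeriv_succ]
    have h : iteratedDeriv m (fun y : ℝ => c * (logitDeriv 0 y : ℂ))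
        =ᶠ[nhds x] fun y => c * (logitDeriv m y : ℂ) := by
      filter_upwards [isOpen_Ioo.mem_nhds hx] with y hy using ih hy
    rw [h.deriv_eq]
    exact ((hasDerivAt_logitDeriv m hx).ofReal_comp.const_mul c).deriv

theorem hasDerivAt_g {p t x : ℝ} (hp : 0 < p) (hx : x ∈ Set.Ioo (0 : ℝ) 1) :
    HasDerivAt (g p t)
      (g p t x * (Complex.I * ((t * p / Real.log 2 : ℝ) : ℂ) * (logitDeriv 0 x : ℂ))) x := by
  have h0 : 0 < x := hx.1
  have h1 : 0 < 1 - x := sub_pos.mpr hx.2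
  have hl2 : Real.log 2 ≠ 0 := (Real.log_pos one_lt_two).ne'
  have hpx : HasDerivAt (fun y : ℝ => p * y) p x := by
    simpa using (hasDerivAt_id x).const_mul p
  have hpx' : HasDerivAt (fun y : ℝ => p * (1 - y)) (-p) x := by
    simpa using ((hasDerivAt_id x).const_sub 1).const_mul p
  have ha := hpx.mul ((hpx.log (by positivity)).div_const (Real.log 2))
  have hb := hpx'.mul ((hpx'.log (by positivity)).div_const (Real.log 2))
  have h := (((ha.add hb).sub_const (p * logb 2 (p / 2))).ofReal_comp.const_mul
    (Complex.I * (t : ℂ))).cexp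
  refine h.congr_deriv ?_
  change Complex.exp _ * _ = Complex.exp _ * _
  congr 1
  rw [mul_assoc Complex.I, mul_assoc Complex.I, ← Complex.ofReal_mul, ← Complex.ofReal_mul]
  congr 2
  rw [logitDeriv, Real.log_mul hp.ne' h0.ne', Real.log_mul hp.ne' h1.ne']
  field_simp
  ring

theorem contDiffAt_g {p t x : ℝ} (hp : 0 < p) (hx : x ∈ Set.Ioo (0 : ℝ) 1) (n : ℕ) :
    ContDiffAt ℝ n (g p t) x := by
  have h0 : p * x ≠ 0 := (mul_pos hp hx.1).ne'
  have h1 : p * (1 - x) ≠ 0 := (mul_pos hp (sub_pos.mpr hx.2)).ne'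
  have h : ContDiffAt ℝ n (fun x : ℝ => p * x * logb 2 (p * x)
      + p * (1 - x) * logb 2 (p * (1 - x)) - p * logb 2 (p / 2)) x := by
    unfold logb
    fun_prop (disch := assumption)
  have h' : ContDiffAt ℝ n (fun x : ℝ => ((p * x * logb 2 (p * x)
      + p * (1 - x) * logb 2 (p * (1 - x)) - p * logb 2 (p / 2) : ℝ) : ℂ)) x :=
    Complex.ofRealCLM.contDiff.contDiffAt.comp x h
  exact (contDiffAt_const.mul h').cexp

theorem contDiffAt_const_mul_logit (c : ℂ) {x : ℝ} (hx : x ∈ Set.Ioo (0 : ℝ) 1) (n : ℕ) :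
    ContDiffAt ℝ n (fun y : ℝ => c * (logitDeriv 0 y : ℂ)) x := by
  have h0 : x ≠ 0 := hx.1.ne'
  have h1 : 1 - x ≠ 0 := (sub_pos.mpr hx.2).ne'
  have h : ContDiffAt ℝ n (logitDeriv 0) x := by
    unfold logitDeriv
    fun_prop (disch := assumption)
  exact contDiffAt_const.mul (Complex.ofRealCLM.contDiff.contDiffAt.comp x h)

theorem norm_iteratedDeriv_g_succ_le {p t x : ℝ} (hp : 0 < p) (hx : x ∈ Set.Ioo (0 : ℝ) 1)
    (k : ℕ) :
    ‖iteratedDeriv (k + 1) (g p t) x‖ ≤ ∑ m ∈ Finset.range (k + 1),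
      (k.choose m : ℝ) * (|t * p / Real.log 2| * ((k + 1 - m).factorial *
        (|logitDeriv (k - m) x| / (k - m + 1).factorial))) * ‖iteratedDeriv m (g p t) x‖ := by
  have h : deriv (g p t) =ᶠ[nhds x] fun y => g p t y *
      (Complex.I * ((t * p / Real.log 2 : ℝ) : ℂ) * (logitDeriv 0 y : ℂ)) := by
    filter_upwards [isOpen_Ioo.mem_nhds hx] with y hy using (hasDerivAt_g hp hy).deriv
  rw [iteratedDeriv_succ', h.iteratedDeriv_eq, iteratedDeriv_fun_mul (contDiffAt_g hp hx k)
    (contDiffAt_const_mul_logit _ hx k)]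
  refine (norm_sum_le _ _).trans_eq (Finset.sum_congr rfl fun m hm => ?_)
  have hm' : k + 1 - m = k - m + 1 := by have := Finset.mem_range.mp hm; omega
  rw [iteratedDeriv_const_mul_logit _ _ hx, hm']
  simp only [norm_mul, Complex.norm_I, Complex.norm_real, Complex.norm_natCast, Real.norm_eq_abs]
  field_simp

theorem norm_g (p t x : ℝ) : ‖g p t x‖ = 1 := by
  rw [g, mul_assoc, ← Complex.ofReal_mul, mul_comm, Complex.norm_exp_ofReal_mul_I]

theorem two_div_mul_pow_monotoneOn {y : ℝ} (hy : 2 ≤ y) {m n : ℕ} (hm : 2 ≤ m) (hmn : m ≤ n) :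
    2 / (((m : ℝ) + 1) * m) * y ^ m ≤ 2 / (((n : ℝ) + 1) * n) * y ^ n := by
  induction n, hmn using Nat.le_induction with
  | base => rfl
  | succ n hn ih =>
    refine ih.trans ?_
    have hn2 : (2 : ℝ) ≤ n := by exact_mod_cast hm.trans hn
    have h : (n : ℝ) + 2 ≤ n * y := by nlinarith
    push_cast
    rw [div_mul_eq_mul_div, div_mul_eq_mul_div, div_le_div_iff₀ (by positivity) (by positivity),
      pow_succ]
    have hc : 0 ≤ 2 * y ^ n * (n + 1) := by positivity
    nlinarith [mul_le_mul_of_nonneg_left h hc]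

theorem le_r (n : ℕ) : n ≤ r n ∧ 5 ≤ r n := by unfold r; omega

theorem r_mono : Monotone r := fun m n h => by unfold r; omega

theorem abs_logitDeriv_le {x : ℝ} (hx : x ∈ Set.Ico (1 / 2 : ℝ) 1) (n : ℕ) :
    |logitDeriv n x| / (n + 1).factorial
      ≤ 2 / (((r n : ℝ) + 1) * r n) * (1 - x)⁻¹ ^ r n := by
  have h0 : 0 < x := by linarith [hx.1]
  have h1 : 0 < 1 - x := sub_pos.mpr hx.2
  obtain ⟨y, hy⟩ : ∃ y, y = (1 - x)⁻¹ := ⟨_, rfl⟩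
  have hy2 : 2 ≤ y := by
    rw [hy, le_inv_comm₀ two_pos h1]; linarith [hx.1]
  have hy5 : y ≤ 2 / (((r n : ℝ) + 1) * r n) * y ^ r n := by
    refine le_trans ?_ (two_div_mul_pow_monotoneOn hy2 (by norm_num) (le_r n).2)
    have : (2 : ℝ) ^ 4 ≤ y ^ 4 := by gcongr
    push_cast
    nlinarith
  rw [← hy]
  match n with
  | 0 =>
    refine le_trans ?_ hy5
    have hl : Real.log (1 - x) ≤ Real.log x := Real.log_le_log h1 (by linarith [hx.1])
    have hx0 : Real.log x ≤ 0 := Real.log_nonpos h0.le hx.2.le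
    have hly := Real.log_le_sub_one_of_pos (show 0 < y by linarith)
    have hlog : Real.log y = -Real.log (1 - x) := by rw [hy, Real.log_inv]
    simp only [logitDeriv, abs_of_nonneg (sub_nonneg.mpr hl)]
    norm_num
    linarith
  | m + 1 =>
    have hm : |logitDeriv (m + 1) x| / (m + 1 + 1).factorial
        ≤ 2 / (((m + 1 : ℕ) + 1 : ℝ) * (m + 1 : ℕ)) * y ^ (m + 1) := by
      have hxy : (x ^ (m + 1))⁻¹ ≤ y ^ (m + 1) := by
        rw [hy, inv_pow]
        gcongr
        linarith [hx.1]
      have h : |(-1) ^ m * (x ^ (m + 1))⁻¹ + ((1 - x) ^ (m + 1))⁻¹| ≤ 2 * y ^ (m + 1) := by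
        refine (abs_add_le _ _).trans ?_
        rw [abs_mul, abs_pow, abs_neg, abs_one, one_pow, one_mul, abs_of_pos (by positivity),
          abs_of_pos (by positivity)]
        rw [← inv_pow (1 - x), ← hy]
        linarith
      rw [logitDeriv, abs_mul, Nat.abs_cast, div_le_iff₀ (by positivity), Nat.factorial_succ,
        Nat.factorial_succ]
      refine (mul_le_mul_of_nonneg_left h (by positivity)).trans_eq ?_
      push_cast
      field_simp
    refine hm.trans ?_
    match m with
    | 0 => exact le_trans (le_of_eq (by norm_num)) hy5
    | m + 1 => exact two_div_mul_pow_monotoneOn hy2 (by omega) (le_r _).1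

theorem norm_iteratedDeriv_g_le {p t x : ℝ} (hp : 0 < p) (hx : x ∈ Set.Ico (1 / 2 : ℝ) 1)
    {k : ℕ} (hk : 1 ≤ k) :
    ‖iteratedDeriv k (g p t) x‖ ≤ ∑ l ∈ Finset.Icc 1 k, |t * p / Real.log 2| ^ l * lah k l *
      (2 / (((r (k - l) : ℝ) + 1) * r (k - l)) * (1 - x)⁻¹ ^ r (k - l)) ^ l := by
  have h1 : 0 < 1 - x := sub_pos.mpr hx.2
  have hy : 2 ≤ (1 - x)⁻¹ := by
    rw [le_inv_comm₀ two_pos h1]; linarith [hx.1]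
  exact le_sum_lah_of_recurrence (G := fun n => ‖iteratedDeriv n (g p t) x‖)
    (u := fun n => |logitDeriv n x| / (n + 1).factorial)
    (U := fun n => 2 / (((r n : ℝ) + 1) * r n) * (1 - x)⁻¹ ^ r n)
    (abs_nonneg _) (by simp [norm_g])
    (fun m n h => two_div_mul_pow_monotoneOn hy (by linarith [(le_r m).2]) (r_mono h))
    (fun n => by positivity) (fun n => norm_nonneg _) (abs_logitDeriv_le hx)
    (norm_iteratedDeriv_g_succ_le hp ⟨by linarith [hx.1], hx.2⟩) hk

theorem integral_one_sub_rpow_le {z s : ℝ} (hz : z ∈ Set.Ico (1 / 2 : ℝ) 1) (hs : 1 < s) :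
    ∫ x in (1 / 2 : ℝ)..z, (1 - x) ^ (-s) ≤ (1 - z) ^ (-s + 1) / (s - 1) := by
  have h1 : 0 < 1 - z := sub_pos.mpr hz.2
  rw [intervalIntegral.integral_comp_sub_left (fun x => x ^ (-s)) 1,
    integral_rpow (Or.inr ⟨by linarith, ?_⟩)]
  · rw [← neg_div_neg_eq, neg_sub, neg_add, neg_neg, ← sub_eq_add_neg]
    gcongr
    have : (0 : ℝ) ≤ (1 - 1 / 2) ^ (-s + 1) := by positivity
    linarith
  · rw [Set.uIcc_of_le (by linarith [hz.1])]
    exact fun h => absurd h.1 (by linarith)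

/-- Minkowski's inequality for a function dominated by a sum of powers of `1 - x`. -/
theorem rpow_integral_rpow_le_sum {ι : Type*} (s : Finset ι) {f : ℝ → ℝ} {A b : ι → ℝ} {z q : ℝ}
    (hz : z ∈ Set.Ico (1 / 2 : ℝ) 1) (hq : 1 ≤ q) (hA : ∀ i ∈ s, 0 ≤ A i)
    (hb : ∀ i ∈ s, 1 < q * b i) (hf0 : ∀ x, 0 ≤ f x)
    (hf : ∀ x ∈ Set.Icc (1 / 2) z, f x ≤ ∑ i ∈ s, A i * (1 - x) ^ (-b i)) :
    (∫ x in (1 / 2 : ℝ)..z, f x ^ q) ^ (1 / q)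
      ≤ ∑ i ∈ s, A i * (1 - z) ^ (-b i + 1 / q) / (q * b i - 1) ^ (1 / q) := by
  have hq0 : 0 < q := by linarith
  have h1 : 0 < 1 - z := sub_pos.mpr hz.2
  let μ := MeasureTheory.volume.restrict (Set.Ioc (1 / 2) z)
  let F : ι → ℝ → ℝ := fun i x => A i * (1 - x) ^ (-b i)
  have hcont : ∀ i, ContinuousOn (F i) (Set.Icc (1 / 2) z) := fun i =>
    continuousOn_const.mul ((continuousOn_const.sub continuousOn_id).rpow_const
      fun x hx => Or.inl (sub_pos.mpr (hx.2.trans_lt hz.2)).ne')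
  have hmem : ∀ G : ℝ → ℝ, ContinuousOn G (Set.Icc (1 / 2) z) →
      MeasureTheory.MemLp G (ENNReal.ofReal q) μ := by
    intro G hG
    obtain ⟨C, hC⟩ := isCompact_Icc.exists_bound_of_continuousOn hG
    refine MeasureTheory.MemLp.of_bound ((hG.mono Set.Ioc_subset_Icc_self).aestronglyMeasurable
      measurableSet_Ioc) C ?_
    filter_upwards [MeasureTheory.ae_restrict_mem measurableSet_Ioc] with x hx
      using hC x (Set.Ioc_subset_Icc_self hx)
  have hlp : ∀ G : ℝ → ℝ, ContinuousOn G (Set.Icc (1 / 2) z) → (∀ x ∈ Set.Icc (1 / 2) z, 0 ≤ G x) →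
      MeasureTheory.lpNorm G (ENNReal.ofReal q) μ
        = (∫ x in (1 / 2 : ℝ)..z, G x ^ q) ^ (1 / q) := by
    intro G hG hG0
    rw [MeasureTheory.lpNorm_eq_integral_norm_rpow_toReal (by simpa using hq0)
      ENNReal.ofReal_ne_top (hmem G hG).1, ENNReal.toReal_ofReal hq0.le, one_div q,
      intervalIntegral.integral_of_le hz.1]
    congr 1
    refine MeasureTheory.setIntegral_congr_fun measurableSet_Ioc fun x hx => ?_
    simp only [Real.norm_of_nonneg (hG0 x (Set.Ioc_subset_Icc_self hx))]
  have hF0 : ∀ i ∈ s, ∀ x ∈ Set.Icc (1 / 2) z, 0 ≤ F i x := fun i hi x hx =>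
    mul_nonneg (hA i hi) (Real.rpow_nonneg (by linarith [hx.2]) _)
  have hS : ContinuousOn (∑ i ∈ s, F i) (Set.Icc (1 / 2) z) := by
    simpa only [Finset.sum_fn] using continuousOn_finsetSum s fun i _ => hcont i
  have hS0 : ∀ x ∈ Set.Icc (1 / 2) z, 0 ≤ (∑ i ∈ s, F i) x := fun x hx => by
    rw [Finset.sum_apply]; exact Finset.sum_nonneg fun i hi => hF0 i hi x hx
  calc (∫ x in (1 / 2 : ℝ)..z, f x ^ q) ^ (1 / q)
      ≤ (∫ x in (1 / 2 : ℝ)..z, (∑ i ∈ s, F i) x ^ q) ^ (1 / q) := by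
        rw [intervalIntegral.integral_of_le hz.1, intervalIntegral.integral_of_le hz.1]
        refine Real.rpow_le_rpow (MeasureTheory.integral_nonneg fun x =>
          Real.rpow_nonneg (hf0 x) _) ?_ (by positivity)
        refine MeasureTheory.integral_mono_of_nonneg
          (.of_forall fun x => Real.rpow_nonneg (hf0 x) _) ?_ ?_
        · exact ((hS.rpow_const fun x _ => Or.inr hq0.le).integrableOn_Icc).mono_set
            Set.Ioc_subset_Icc_self
        · filter_upwards [MeasureTheory.ae_restrict_mem measurableSet_Ioc] with x hx
          refine Real.rpow_le_rpow (hf0 x) ?_ hq0.le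
          rw [Finset.sum_apply]
          exact hf x (Set.Ioc_subset_Icc_self hx)
    _ = MeasureTheory.lpNorm (∑ i ∈ s, F i) (ENNReal.ofReal q) μ := (hlp _ hS hS0).symm
    _ ≤ ∑ i ∈ s, MeasureTheory.lpNorm (F i) (ENNReal.ofReal q) μ :=
        MeasureTheory.lpNorm_sum_le (fun i _ => hmem _ (hcont i)) (by simpa using hq)
    _ ≤ _ := Finset.sum_le_sum fun i hi => ?_
  rw [hlp _ (hcont i) (hF0 i hi)]
  have hint : ∫ x in (1 / 2 : ℝ)..z, F i x ^ q
      = A i ^ q * ∫ x in (1 / 2 : ℝ)..z, (1 - x) ^ (-(q * b i)) := by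
    rw [← intervalIntegral.integral_const_mul]
    refine intervalIntegral.integral_congr fun x hx => ?_
    rw [Set.uIcc_of_le hz.1] at hx
    have hx1 : 0 ≤ 1 - x := by linarith [hx.2]
    simp only [F]
    rw [Real.mul_rpow (hA i hi) (Real.rpow_nonneg hx1 _), ← Real.rpow_mul hx1]
    ring_nf
  have hAq : 0 ≤ A i ^ q := Real.rpow_nonneg (hA i hi) _
  have hbi : 0 < q * b i - 1 := by linarith [hb i hi]
  calc (∫ x in (1 / 2 : ℝ)..z, F i x ^ q) ^ (1 / q)
      ≤ (A i ^ q * ((1 - z) ^ (-(q * b i) + 1) / (q * b i - 1))) ^ (1 / q) := by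
        refine Real.rpow_le_rpow ?_ ?_ (by positivity)
        · exact intervalIntegral.integral_nonneg hz.1 fun x hx =>
            Real.rpow_nonneg (hF0 i hi x hx) _
        · rw [hint]
          exact mul_le_mul_of_nonneg_left (integral_one_sub_rpow_le hz (hb i hi)) hAq
    _ = _ := by
        rw [Real.mul_rpow hAq (by positivity), ← Real.rpow_mul (hA i hi), mul_one_div_cancel hq0.ne',
          Real.rpow_one, Real.div_rpow (by positivity) hbi.le, ← Real.rpow_mul h1.le, mul_div_assoc]
        congr 4
        field_simp

theorem stmt19 (k : ℕ) (hk : 1 ≤ k) (q : ℝ) (hq : 1 ≤ q) (z : ℝ)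
    (hz : z ∈ Set.Ico (1 / 2 : ℝ) 1) (t : ℝ) (p : ℝ) (hp : p ∈ Set.Ioc (0 : ℝ) 1) :
    (∫ x in (1 / 2 : ℝ)..z, ‖iteratedDeriv k (g p t) x‖ ^ q) ^ (1 / q)
      ≤ ∑ l ∈ Finset.Icc 1 k,
          |t * p / Real.log 2| ^ l * lah k l *
            (2 / (((r (k - l) : ℝ) + 1) * (r (k - l) : ℝ))) ^ l *
            (1 - z) ^ (-((l * r (k - l) : ℕ) : ℝ) + 1 / q) /
            (q * (l : ℝ) * (r (k - l) : ℝ) - 1) ^ (1 / q) := by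
  have h := rpow_integral_rpow_le_sum (Finset.Icc 1 k)
    (f := fun x => ‖iteratedDeriv k (g p t) x‖)
    (A := fun l => |t * p / Real.log 2| ^ l * lah k l *
      (2 / (((r (k - l) : ℝ) + 1) * (r (k - l) : ℝ))) ^ l)
    (b := fun l => ((l * r (k - l) : ℕ) : ℝ)) hz hq
    (fun l _ => by have := lah_nonneg k l; positivity)
    (fun l hl => ?_) (fun x => norm_nonneg _) (fun x hx => ?_)
  · refine h.trans_eq (Finset.sum_congr rfl fun l _ => ?_)
    simp only [Nat.cast_mul, mul_assoc]
  · have hl1 : (1 : ℝ) ≤ l := by exact_mod_cast (Finset.mem_Icc.mp hl).1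
    have hr5 : (5 : ℝ) ≤ r (k - l) := by exact_mod_cast (le_r (k - l)).2
    push_cast
    have : (1 : ℝ) ≤ q * l := one_le_mul_of_one_le_of_one_le hq hl1
    nlinarith
  · refine (norm_iteratedDeriv_g_le hp.1 ⟨hx.1, hx.2.trans_lt hz.2⟩ hk).trans_eq
      (Finset.sum_congr rfl fun l _ => ?_)
    have hx1 : 0 ≤ 1 - x := by linarith [hx.2, hz.2]
    rw [Real.rpow_neg hx1, Real.rpow_natCast, mul_pow, inv_pow, inv_pow, ← pow_mul,
      mul_comm l (r (k - l)), mul_assoc, mul_assoc, mul_assoc]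
end
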